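/- Let σ > 0, P > 0, let μ_H be the standard circularly-symmetric complex Gaussian measure on ℂ, and let μ be a π/2-symmetric probability measure on ℂ concentrated on the circle of radius √P (i.e. μ({x : |x| = √P}) = 1). Then the conditional mutual information of the 1-bit I/Q communication channel with receiver CSI, expressed as I = ∫ ∑_{l=0}^{3} ξ(∫ W_σ(y_l, h·x) dμ(x)) dμ_H(h) − ∫∫ ∑_{l=0}^{3} ξ(W_σ(y_l, h·x)) dμ(x) dμ_H(h), equals the closed form I = 2 − ∫ [ H_b(Q(√(2P)·|Re h|/σ)) + H_b(Q(√(2P)·|Im h|/σ)) ] dμ_H(h). -/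

import Mathlib

open MeasureTheory ProbabilityTheory

/-- Standard Gaussian tail function. -/
noncomputable def Qtail (x : ℝ) : ℝ := ((gaussianReal 0 1) (Set.Ioi x)).toReal

/-- 1-bit quantizer output points `y_l = i^l * (1 + i)`. -/
noncomputable def ypt (l : ℕ) : ℂ := Complex.I ^ l * (1 + Complex.I)

/-- 1-bit I/Q channel law. -/
noncomputable def Wlaw (σ : ℝ) (l : ℕ) (z : ℂ) : ℝ :=
  Qtail (-(z.re * (ypt l).re) / (σ / Real.sqrt 2)) *
  Qtail (-(z.im * (ypt l).im) / (σ / Real.sqrt 2))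

/-- `ξ x = -x * log₂ x` (with `ξ 0 = 0`). -/
noncomputable def xi (x : ℝ) : ℝ := -x * Real.logb 2 x

/-- Binary entropy function in bits. -/
noncomputable def Hb (p : ℝ) : ℝ := xi p + xi (1 - p)

/-- Standard circularly-symmetric complex Gaussian measure on ℂ. -/
noncomputable def muH : Measure ℂ :=
  Measure.map (fun p : ℝ × ℝ => (p.1 : ℂ) + (p.2 : ℂ) * Complex.I)
    ((gaussianReal 0 (1/2)).prod (gaussianReal 0 (1/2)))

theorem Q_nonneg (x : ℝ) : 0 ≤ Qtail x := ENNReal.toReal_nonneg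

theorem Q_le_one (x : ℝ) : Qtail x ≤ 1 := by
  unfold Qtail
  exact measureReal_le_one (μ := gaussianReal 0 1) (s := Set.Ioi x)

theorem Q_neg (x : ℝ) : Qtail (-x) = 1 - Qtail x := by
  have h1 : (gaussianReal 0 1).map (fun y : ℝ => -y) = gaussianReal 0 1 := by
    rw [gaussianReal_map_neg]; simp
  have h2 : (gaussianReal 0 1) (Set.Ioi (-x)) = (gaussianReal 0 1) (Set.Iio x) := by
    conv_lhs => rw [← h1]
    rw [Measure.map_apply measurable_neg measurableSet_Ioi]
    congr 1; ext y; simp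
  have : NullSingletonClass (gaussianReal 0 1) := nullSingletonClass_gaussianReal (by simp)
  have h3 : (gaussianReal 0 1) (Set.Iio x) = (gaussianReal 0 1) (Set.Iic x) :=
    measure_congr Iio_ae_eq_Iic
  have h4 : (gaussianReal 0 1).real (Set.Iic x) = 1 - (gaussianReal 0 1).real (Set.Ioi x) := by
    rw [← Set.compl_Ioi, probReal_compl_eq_one_sub measurableSet_Ioi]
  unfold Qtail
  rw [h2, h3]
  exact h4

theorem Q_meas : Measurable Qtail := by
  apply Antitone.measurable
  intro a b hab
  exact measureReal_mono (μ := gaussianReal 0 1) (Set.Ioi_subset_Ioi hab)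

theorem xi_eq (x : ℝ) : xi x = Real.negMulLog x / Real.log 2 := by
  unfold xi Real.negMulLog Real.logb; ring

theorem xi_cont : Continuous xi := by
  have : xi = fun x => Real.negMulLog x / Real.log 2 := funext xi_eq
  rw [this]; exact Real.continuous_negMulLog.div_const _

theorem xi_mul (p q : ℝ) : xi (p * q) = q * xi p + p * xi q := by
  simp only [xi_eq, Real.negMulLog_mul]; ring

theorem Hb_cont : Continuous Hb := by
  unfold Hb
  exact xi_cont.add (xi_cont.comp (continuous_const.sub continuous_id))

theorem Hb_bdd : ∃ C, ∀ p ∈ Set.Icc (0:ℝ) 1, ‖Hb p‖ ≤ C :=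
  isCompact_Icc.exists_bound_of_continuousOn Hb_cont.continuousOn

theorem ypt_succ_re (l : ℕ) : (ypt (l+1)).re = -(ypt l).im := by
  unfold ypt; rw [pow_succ', mul_assoc, Complex.I_mul_re]

theorem ypt_succ_im (l : ℕ) : (ypt (l+1)).im = (ypt l).re := by
  unfold ypt; rw [pow_succ', mul_assoc, Complex.I_mul_im]

theorem ypt0re : (ypt 0).re = 1 := by simp [ypt]
theorem ypt0im : (ypt 0).im = 1 := by simp [ypt]

theorem W_succ (σ : ℝ) (l : ℕ) (z : ℂ) : Wlaw σ (l+1) (Complex.I * z) = Wlaw σ l z := by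
  unfold Wlaw
  rw [ypt_succ_re, ypt_succ_im, Complex.I_mul_re, Complex.I_mul_im, mul_comm]
  congr 3; ring

theorem W_meas (σ : ℝ) (l : ℕ) : Measurable (Wlaw σ l) := by
  unfold Wlaw
  refine (Q_meas.comp ?_).mul (Q_meas.comp ?_)
  · exact ((Complex.measurable_re.mul_const _).neg).div_const _
  · exact ((Complex.measurable_im.mul_const _).neg).div_const _

theorem W_bdd (σ : ℝ) (l : ℕ) (z : ℂ) : ‖Wlaw σ l z‖ ≤ 1 := by
  unfold Wlaw
  rw [Real.norm_of_nonneg (mul_nonneg (Q_nonneg _) (Q_nonneg _))]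
  exact mul_le_one₀ (Q_le_one _) (Q_nonneg _) (Q_le_one _)

/-- The four values of the law. -/
theorem W_vals (σ : ℝ) (z : ℂ) :
    Wlaw σ 0 z = (1 - Qtail (z.re / (σ / √2))) * (1 - Qtail (z.im / (σ / √2))) ∧
    Wlaw σ 1 z = Qtail (z.re / (σ / √2)) * (1 - Qtail (z.im / (σ / √2))) ∧
    Wlaw σ 2 z = Qtail (z.re / (σ / √2)) * Qtail (z.im / (σ / √2)) ∧
    Wlaw σ 3 z = (1 - Qtail (z.re / (σ / √2))) * Qtail (z.im / (σ / √2)) := by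
  have r1 : (ypt 1).re = -1 := by rw [ypt_succ_re 0, ypt0im]
  have i1 : (ypt 1).im = 1 := by rw [ypt_succ_im 0, ypt0re]
  have r2 : (ypt 2).re = -1 := by rw [ypt_succ_re 1, i1]
  have i2 : (ypt 2).im = -1 := by rw [ypt_succ_im 1, r1]
  have r3 : (ypt 3).re = 1 := by rw [ypt_succ_re 2, i2, neg_neg]
  have i3 : (ypt 3).im = -1 := by rw [ypt_succ_im 2, r2]
  simp only [Wlaw, ypt0re, ypt0im, r1, i1, r2, i2, r3, i3, ← Q_neg, neg_div, mul_one, mul_neg,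
    neg_neg, and_self]

theorem W_sum (σ : ℝ) (z : ℂ) : ∑ l ∈ Finset.range 4, Wlaw σ l z = 1 := by
  obtain ⟨h0, h1, h2, h3⟩ := W_vals σ z
  simp only [Finset.sum_range_succ, Finset.sum_range_zero, h0, h1, h2, h3]; ring

/-- Total entropy of the quantizer output for a given noiseless input. -/
noncomputable def gent (σ : ℝ) (z : ℂ) : ℝ :=
  Hb (Qtail (z.re / (σ / √2))) + Hb (Qtail (z.im / (σ / √2)))

theorem W_ent (σ : ℝ) (z : ℂ) : ∑ l ∈ Finset.range 4, xi (Wlaw σ l z) = gent σ z := by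
  obtain ⟨h0, h1, h2, h3⟩ := W_vals σ z
  simp only [Finset.sum_range_succ, Finset.sum_range_zero, h0, h1, h2, h3, xi_mul, gent, Hb]; ring

theorem gent_meas (σ : ℝ) : Measurable (gent σ) := by
  unfold gent
  refine (Hb_cont.measurable.comp (Q_meas.comp ?_)).add (Hb_cont.measurable.comp (Q_meas.comp ?_))
  · exact Complex.measurable_re.div_const _
  · exact Complex.measurable_im.div_const _

theorem gent_bdd (σ : ℝ) : ∃ C, ∀ z, ‖gent σ z‖ ≤ C := by
  obtain ⟨C, hC⟩ := Hb_bdd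
  exact ⟨C + C, fun z => (norm_add_le _ _).trans
    (add_le_add (hC _ ⟨Q_nonneg _, Q_le_one _⟩) (hC _ ⟨Q_nonneg _, Q_le_one _⟩))⟩

theorem Hb_Q_abs (x : ℝ) : Hb (Qtail |x|) = Hb (Qtail x) := by
  rcases abs_choice x with h | h
  · rw [h]
  · rw [h, Q_neg]; unfold Hb; rw [sub_sub_cancel, add_comm]

theorem mk_meas : Measurable (fun p : ℝ × ℝ => (p.1 : ℂ) + (p.2 : ℂ) * Complex.I) := by
  fun_prop

instance : IsProbabilityMeasure muH := by
  unfold muH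
  exact Measure.isProbabilityMeasure_map mk_meas.aemeasurable

theorem muH_charFun (t : ℂ) : charFun muH t = Complex.exp (-(‖t‖ ^ 2 / 4 : ℝ)) := by
  rw [charFun_apply, muH, integral_map mk_meas.aemeasurable (by fun_prop)]
  have : ∀ p : ℝ × ℝ, Complex.exp (inner ℝ ((p.1 : ℂ) + (p.2 : ℂ) * Complex.I) t * Complex.I)
      = Complex.exp (t.re * p.1 * Complex.I) * Complex.exp (t.im * p.2 * Complex.I) := by
    intro p
    rw [← Complex.exp_add, Complex.inner]
    congr 1
    simp
    ring
  simp_rw [this]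
  rw [integral_prod_mul (fun a : ℝ => Complex.exp (t.re * a * Complex.I))
    (fun a : ℝ => Complex.exp (t.im * a * Complex.I)), ← charFun_apply_real, ← charFun_apply_real,
    charFun_gaussianReal, charFun_gaussianReal, ← Complex.exp_add, Complex.sq_norm,
    Complex.normSq_apply]
  congr 1
  push_cast
  simp
  ring

theorem muH_rot (c : ℂ) (hc : ‖c‖ = 1) : muH.map (fun z => c * z) = muH := by
  haveI : IsProbabilityMeasure (muH.map (fun z => c * z)) :=
    Measure.isProbabilityMeasure_map (by fun_prop)
  apply Measure.ext_of_charFun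
  funext t
  have : charFun (muH.map (fun z => c * z)) t = charFun muH ((starRingEnd ℂ) c * t) := by
    rw [charFun_apply, charFun_apply, integral_map (by fun_prop) (by fun_prop)]
    congr 1; funext z
    rw [Complex.inner, Complex.inner]
    congr 4
    simp only [map_mul]; ring
  rw [this, muH_charFun, muH_charFun, norm_mul, RCLike.norm_conj, hc, one_mul]

theorem int_gent (σ P : ℝ) (hP : 0 < P) (x : ℂ) (hx : ‖x‖ = √P) :
    ∫ h, gent σ (h * x) ∂muH = ∫ h, gent σ (h * (√P : ℝ)) ∂muH := by
  have hs : 0 < √P := Real.sqrt_pos.2 hP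
  have hs' : ((√P : ℝ) : ℂ) ≠ 0 := by exact_mod_cast hs.ne'
  have hc : ‖x / (√P : ℝ)‖ = 1 := by
    rw [norm_div, hx, Complex.norm_real, Real.norm_of_nonneg hs.le, div_self hs.ne']
  conv_rhs => rw [← muH_rot _ hc]
  rw [integral_map (f := fun h => gent σ (h * (√P : ℝ))) (by fun_prop)
    ((gent_meas σ).comp (by fun_prop : Measurable fun h : ℂ => h * (√P : ℝ))).aestronglyMeasurable]
  congr 1; funext h; congr 1; field_simp

theorem int_W (σ : ℝ) (μ : Measure ℂ) [IsProbabilityMeasure μ]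
    (hsym : Measure.map (fun x : ℂ => Complex.I * x) μ = μ) (h : ℂ) (l : ℕ) :
    ∫ x, Wlaw σ l (h * x) ∂μ = 1 / 4 := by
  have hm : ∀ l, Measurable fun x => Wlaw σ l (h * x) := fun l =>
    (W_meas σ l).comp (by fun_prop)
  have hs : ∀ l, ∫ x, Wlaw σ (l+1) (h * x) ∂μ = ∫ x, Wlaw σ l (h * x) ∂μ := by
    intro l
    conv_lhs => rw [← hsym]
    rw [integral_map (by fun_prop) (hm _).aestronglyMeasurable]
    congr 1; funext x
    rw [← W_succ σ l]; congr 1; ring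
  have hall : ∀ l, ∫ x, Wlaw σ l (h * x) ∂μ = ∫ x, Wlaw σ 0 (h * x) ∂μ := by
    intro l
    induction l with
    | zero => rfl
    | succ k ih => rw [hs, ih]
  have hi : ∫ x, ∑ l ∈ Finset.range 4, Wlaw σ l (h * x) ∂μ = 1 := by
    simp [W_sum]
  rw [integral_finsetSum _ (fun l _ => Integrable.of_bound (hm l).aestronglyMeasurable 1
    (Filter.Eventually.of_forall fun x => W_bdd σ l _))] at hi
  simp only [hall, Finset.sum_const, Finset.card_range, nsmul_eq_mul] at hi
  rw [hall]
  push_cast at hi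
  linarith

theorem xi_quarter : xi (1 / 4) = 1 / 2 := by
  unfold xi
  have : Real.logb 2 (1 / 4) = -2 := by
    rw [show (1 / 4 : ℝ) = (2:ℝ) ^ (-2 : ℝ) by norm_num [Real.rpow_neg]]
    exact Real.logb_rpow (by norm_num) (by norm_num)
  rw [this]; norm_num

theorem stmt11 (σ P : ℝ) (hσ : 0 < σ) (hP : 0 < P)
    (μ : Measure ℂ) [IsProbabilityMeasure μ]
    (hsym : Measure.map (fun x : ℂ => Complex.I * x) μ = μ)
    (hcirc : μ {x : ℂ | ‖x‖ = Real.sqrt P} = 1) :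
    (∫ h, ∑ l ∈ Finset.range 4, xi (∫ x, Wlaw σ l (h * x) ∂μ) ∂muH)
        - ∫ h, ∫ x, ∑ l ∈ Finset.range 4, xi (Wlaw σ l (h * x)) ∂μ ∂muH
      = 2 - ∫ h, (Hb (Qtail (Real.sqrt (2 * P) * |h.re| / σ))
            + Hb (Qtail (Real.sqrt (2 * P) * |h.im| / σ))) ∂muH := by
  simp_rw [W_ent, int_W σ μ hsym, xi_quarter]
  have h1 : ∫ h, ∫ x, gent σ (h * x) ∂μ ∂muH = ∫ h, gent σ (h * (√P : ℝ)) ∂muH := by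
    obtain ⟨C, hC⟩ := gent_bdd σ
    rw [integral_integral_swap (f := fun h x => gent σ (h * x))
      (Integrable.of_bound ((gent_meas σ).comp
        (by fun_prop : Measurable fun p : ℂ × ℂ => p.1 * p.2)).aestronglyMeasurable C
        (Filter.Eventually.of_forall fun p => hC _))]
    have hae : ∀ᵐ x ∂μ, ‖x‖ = √P :=
      (prob_compl_eq_zero_iff (measurableSet_eq_fun measurable_norm measurable_const)).2 hcirc
    rw [integral_congr_ae (hae.mono fun x hx => int_gent σ P hP x hx)]
    simp
  rw [h1]
  congr 1
  · simp; norm_num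
  · congr 1; funext h
    have key : ∀ r : ℝ, √(2 * P) * |r| / σ = |r * √P / (σ / √2)| := by
      intro r
      rw [abs_div, abs_mul, abs_div, abs_of_pos hσ, abs_of_nonneg (Real.sqrt_nonneg P),
        abs_of_nonneg (Real.sqrt_nonneg 2), Real.sqrt_mul (by norm_num)]
      field_simp
    rw [key, key, Hb_Q_abs, Hb_Q_abs, gent, Complex.re_mul_ofReal, Complex.im_mul_ofReal]
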